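/- If the constructed Strip Packing items admit a feasible packing into a strip of width W with height at most 4, then the 3-Partition instance is a Yes-instance. Consequently, for a No-instance every feasible packing of the constructed items into a strip of width W has height at least 5. -/

import Mathlib

/-- Jobs of the instance constructed from a 3-Partition instance with parameter `z`. -/
inductive Job (z : ℕ) : Type
  | JA (i : Fin (z+1))
  | JB (i : Fin (z+1))
  | Ja (i : Fin z)
  | Jb (i : Fin z)
  | Jc (j : Fin (z+1))
  | Jα (i : Fin z)
  | Jβ (i : Fin z)
  | Jγ (j : Fin z)
  | Jδ (j : Fin z)
  | Jl1
  | Jl2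
  | Jpart (i : Fin (3*z))
  deriving DecidableEq, Fintype

/-- Processing times of the constructed jobs (`γ_j`, `δ_j` use index `j ∈ {1,…,z}`,
represented by `j.val + 1` for `j : Fin z`). -/
def pJob (z D : ℕ) (ι : Fin (3*z) → ℕ) : Job z → ℕ
  | .JA _ => D^2
  | .JB _ => D^3
  | .Ja _ => D^4 + D^6 + 3*z*D^7
  | .Jb _ => D^5 + D^6 + 3*z*D^7
  | .Jc j => (z + j.val)*D^7 + D^8
  | .Jα _ => D^3 + D^5 + 4*z*D^7 + D^8
  | .Jβ _ => D^2 + D^4 + (4*z-1)*D^7 + D^8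
  | .Jγ j => D^5 + (3*z - (j.val+1))*D^7 - D
  | .Jδ j => D^4 + (3*z - (j.val+1))*D^7
  | .Jl1 => D^3 + z*D^7 + D^8
  | .Jl2 => D^2 + 2*z*D^7 + D^8
  | .Jpart i => ι i

/-- Machine requirements of the constructed jobs. -/
def qJob (z : ℕ) : Job z → ℕ
  | .JA _ => 3
  | .JB _ => 3
  | .Ja _ => 2
  | .Jb _ => 2
  | .Jc _ => 2
  | _ => 1

/-- Feasibility of a schedule `(σ, ρ)` on machines `{1,…,m}`: every job gets `q j`
machines among `{1,…,m}`, and jobs sharing a machine have disjoint half-open intervals. -/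
def Feasible {J : Type} (m : ℕ) (p q : J → ℕ) (σ : J → ℕ) (ρ : J → Finset ℕ) : Prop :=
  (∀ j, ρ j ⊆ Finset.Icc 1 m) ∧ (∀ j, (ρ j).card = q j) ∧
  (∀ j j', j ≠ j' → (ρ j ∩ ρ j').Nonempty →
    σ j + p j ≤ σ j' ∨ σ j' + p j' ≤ σ j)

/-- Makespan of a schedule. -/
def makespan {J : Type} [Fintype J] (p σ : J → ℕ) : ℕ :=
  Finset.univ.sup fun j => σ j + p j

/-- The target makespan `W`. -/
def Wval (z D : ℕ) : ℕ :=
  (z+1)*(D^2 + D^3 + D^8) + z*(D^4 + D^5 + D^6) + z*(7*z+1)*D^7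

/-- The 3-Partition instance `ι` is a Yes-instance. -/
def IsYes (z D : ℕ) (ι : Fin (3*z) → ℕ) : Prop :=
  ∃ f : Fin (3*z) → Fin z,
    ∀ k : Fin z, ∑ i ∈ Finset.univ.filter (fun i => f i = k), ι i = D

/-- Jobs processed on machine 1 in a normal-form schedule: `A ∪ a ∪ α ∪ {λ₁}`. -/
def M1Jobs {z : ℕ} : Job z → Prop
  | .JA _ => True
  | .Ja _ => True
  | .Jα _ => True
  | .Jl1 => True
  | _ => False

/-- Jobs processed on machine 4 in a normal-form schedule: `B ∪ b ∪ β ∪ {λ₂}`. -/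
def M4Jobs {z : ℕ} : Job z → Prop
  | .JB _ => True
  | .Jb _ => True
  | .Jβ _ => True
  | .Jl2 => True
  | _ => False

/-- Jobs processed on both machines 2 and 3: `A ∪ B ∪ c`. -/
def BothM23 {z : ℕ} : Job z → Prop
  | .JA _ => True
  | .JB _ => True
  | .Jc _ => True
  | _ => False

/-- Jobs processed on exactly one of machines 2 and 3: `a ∪ b ∪ γ ∪ δ ∪ P`. -/
def OneM23 {z : ℕ} : Job z → Prop
  | .Ja _ => True
  | .Jb _ => True
  | .Jγ _ => True
  | .Jδ _ => True
  | .Jpart _ => True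
  | _ => False

/-- Normal form of a schedule of the constructed instance. -/
def NormalForm {z : ℕ} (ρ : Job z → Finset ℕ) : Prop :=
  (∀ j, 1 ∈ ρ j ↔ M1Jobs j) ∧
  (∀ j, 4 ∈ ρ j ↔ M4Jobs j) ∧
  (∀ j, BothM23 j → 2 ∈ ρ j ∧ 3 ∈ ρ j) ∧
  (∀ j, OneM23 j → ((2 ∈ ρ j) ↔ ¬ (3 ∈ ρ j)))

/-- `cnt p σ S i` = number of jobs of `S` finishing no later than the start of `i`
(the quantity `#ᵢ S`). -/
def cnt {z : ℕ} (p σ : Job z → ℕ) (S : Finset (Job z)) (i : Job z) : ℕ :=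
  (S.filter fun j => σ j + p j ≤ σ i).card

def sA (z : ℕ) : Finset (Job z) := Finset.univ.image Job.JA
def sB (z : ℕ) : Finset (Job z) := Finset.univ.image Job.JB
def sa (z : ℕ) : Finset (Job z) := Finset.univ.image Job.Ja
def sb (z : ℕ) : Finset (Job z) := Finset.univ.image Job.Jb
def sc (z : ℕ) : Finset (Job z) := Finset.univ.image Job.Jc
def sα (z : ℕ) : Finset (Job z) := Finset.univ.image Job.Jα
def sβ (z : ℕ) : Finset (Job z) := Finset.univ.image Job.Jβ
def sγ (z : ℕ) : Finset (Job z) := Finset.univ.image Job.Jγ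
def sδ (z : ℕ) : Finset (Job z) := Finset.univ.image Job.Jδ

/-- Feasibility of a strip packing of items with widths `w` and heights `h` into a strip
of width `Wd`: items fit horizontally and open rectangles are pairwise disjoint. -/
def PackFeasible {J : Type} (Wd : ℕ) (w h : J → ℕ) (x y : J → ℕ) : Prop :=
  (∀ j, x j + w j ≤ Wd) ∧
  (∀ j j', j ≠ j' →
    x j + w j ≤ x j' ∨ x j' + w j' ≤ x j ∨ y j + h j ≤ y j' ∨ y j' + h j' ≤ y j)

namespace SP

def tg {z : ℕ} : Job z → ℕ
  | .JA _ => 0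
  | .JB _ => 1
  | .Ja _ => 2
  | .Jb _ => 3
  | .Jc _ => 4
  | .Jα _ => 5
  | .Jβ _ => 6
  | .Jγ _ => 7
  | .Jδ _ => 8
  | .Jl1 => 9
  | .Jl2 => 10
  | .Jpart _ => 11

def cv {z : ℕ} : Job z → ℕ
  | .Jc j => z + j.val
  | _ => 0

def gd {z : ℕ} : Job z → ℕ
  | .Jγ j => 3*z - (j.val+1)
  | .Jδ j => 3*z - (j.val+1)
  | _ => 0

def io {z : ℕ} (ι : Fin (3*z) → ℕ) : Job z → ℕ
  | .Jpart i => ι i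
  | _ => 0

def nn {z : ℕ} (k : ℕ) (S : Finset (Job z)) : ℕ := ∑ j ∈ S, if tg j = k then 1 else 0

def d7 {z : ℕ} (S : Finset (Job z)) : ℕ :=
  3*z*(nn 2 S + nn 3 S) + 4*z*nn 5 S + (4*z-1)*nn 6 S + z*nn 9 S + 2*z*nn 10 S
    + ∑ j ∈ S, cv j + ∑ j ∈ S, gd j

theorem p_digits (z D : ℕ) (ι : Fin (3*z) → ℕ) (hD : 0 < D) (j : Job z) :
    pJob z D ι j + (if tg j = 7 then 1 else 0) * D = io ι j
      + ((if tg j = 0 then 1 else 0) + (if tg j = 6 then 1 else 0) + (if tg j = 10 then 1 else 0)) * D^2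
      + ((if tg j = 1 then 1 else 0) + (if tg j = 5 then 1 else 0) + (if tg j = 9 then 1 else 0)) * D^3
      + ((if tg j = 2 then 1 else 0) + (if tg j = 6 then 1 else 0) + (if tg j = 8 then 1 else 0)) * D^4
      + ((if tg j = 3 then 1 else 0) + (if tg j = 7 then 1 else 0) + (if tg j = 5 then 1 else 0)) * D^5
      + ((if tg j = 2 then 1 else 0) + (if tg j = 3 then 1 else 0)) * D^6
      + (3*z*((if tg j = 2 then 1 else 0) + (if tg j = 3 then 1 else 0))
          + 4*z*(if tg j = 5 then 1 else 0) + (4*z-1)*(if tg j = 6 then 1 else 0)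
          + z*(if tg j = 9 then 1 else 0) + 2*z*(if tg j = 10 then 1 else 0) + cv j + gd j) * D^7
      + ((if tg j = 4 then 1 else 0) + (if tg j = 5 then 1 else 0) + (if tg j = 6 then 1 else 0)
          + (if tg j = 9 then 1 else 0) + (if tg j = 10 then 1 else 0)) * D^8 := by
  cases j with
  | Jγ j =>
    simp only [pJob, tg, cv, gd, io]
    have : D ≤ D^5 := Nat.le_self_pow (by norm_num) D
    norm_num
    omega
  | _ => simp [pJob, tg, cv, gd, io]

theorem sum_digits (z D : ℕ) (ι : Fin (3*z) → ℕ) (hD : 0 < D) (S : Finset (Job z)) :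
    ∑ j ∈ S, pJob z D ι j + nn 7 S * D = ∑ j ∈ S, io ι j
      + (nn 0 S + nn 6 S + nn 10 S) * D^2
      + (nn 1 S + nn 5 S + nn 9 S) * D^3
      + (nn 2 S + nn 6 S + nn 8 S) * D^4
      + (nn 3 S + nn 7 S + nn 5 S) * D^5
      + (nn 2 S + nn 3 S) * D^6
      + d7 S * D^7
      + (nn 4 S + nn 5 S + nn 6 S + nn 9 S + nn 10 S) * D^8 := by
  have h := Finset.sum_congr (rfl : S = S) (fun j _ => p_digits z D ι hD j)
  simp only [Finset.sum_add_distrib, ← Finset.sum_mul, ← Finset.mul_sum] at h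
  exact h

def eqv (z : ℕ) : Job z ≃ (Fin (z+1) ⊕ Fin (z+1) ⊕ Fin z ⊕ Fin z ⊕ Fin (z+1) ⊕ Fin z ⊕ Fin z ⊕
    Fin z ⊕ Fin z ⊕ Unit ⊕ Unit ⊕ Fin (3*z)) where
  toFun
  | .JA i => .inl i
  | .JB i => .inr (.inl i)
  | .Ja i => .inr (.inr (.inl i))
  | .Jb i => .inr (.inr (.inr (.inl i)))
  | .Jc i => .inr (.inr (.inr (.inr (.inl i))))
  | .Jα i => .inr (.inr (.inr (.inr (.inr (.inl i)))))
  | .Jβ i => .inr (.inr (.inr (.inr (.inr (.inr (.inl i))))))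
  | .Jγ i => .inr (.inr (.inr (.inr (.inr (.inr (.inr (.inl i)))))))
  | .Jδ i => .inr (.inr (.inr (.inr (.inr (.inr (.inr (.inr (.inl i))))))))
  | .Jl1 => .inr (.inr (.inr (.inr (.inr (.inr (.inr (.inr (.inr (.inl ())))))))))
  | .Jl2 => .inr (.inr (.inr (.inr (.inr (.inr (.inr (.inr (.inr (.inr (.inl ()))))))))))
  | .Jpart i => .inr (.inr (.inr (.inr (.inr (.inr (.inr (.inr (.inr (.inr (.inr i))))))))))
  invFun
  | .inl i => .JA i
  | .inr (.inl i) => .JB i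
  | .inr (.inr (.inl i)) => .Ja i
  | .inr (.inr (.inr (.inl i))) => .Jb i
  | .inr (.inr (.inr (.inr (.inl i)))) => .Jc i
  | .inr (.inr (.inr (.inr (.inr (.inl i))))) => .Jα i
  | .inr (.inr (.inr (.inr (.inr (.inr (.inl i)))))) => .Jβ i
  | .inr (.inr (.inr (.inr (.inr (.inr (.inr (.inl i))))))) => .Jγ i
  | .inr (.inr (.inr (.inr (.inr (.inr (.inr (.inr (.inl i)))))))) => .Jδ i
  | .inr (.inr (.inr (.inr (.inr (.inr (.inr (.inr (.inr (.inl _))))))))) => .Jl1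
  | .inr (.inr (.inr (.inr (.inr (.inr (.inr (.inr (.inr (.inr (.inl _)))))))))) => .Jl2
  | .inr (.inr (.inr (.inr (.inr (.inr (.inr (.inr (.inr (.inr (.inr i)))))))))) => .Jpart i
  left_inv j := by cases j <;> rfl
  right_inv j := by
    rcases j with i|i|i|i|i|i|i|i|i|i|i|i <;> rfl

theorem job_sum {z : ℕ} (f : Job z → ℕ) : ∑ j, f j =
    ∑ i, f (.JA i) + (∑ i, f (.JB i) + (∑ i, f (.Ja i) + (∑ i, f (.Jb i) + (∑ i, f (.Jc i)
    + (∑ i, f (.Jα i) + (∑ i, f (.Jβ i) + (∑ i, f (.Jγ i) + (∑ i, f (.Jδ i)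
    + (f .Jl1 + (f .Jl2 + ∑ i, f (.Jpart i))))))))))) := by
  rw [← Equiv.sum_comp (eqv z).symm]
  simp only [Fintype.sum_sum_type]
  simp [eqv]

def tot (z : ℕ) : ℕ → ℕ
  | 0 => z+1 | 1 => z+1 | 2 => z | 3 => z | 4 => z+1 | 5 => z | 6 => z | 7 => z | 8 => z
  | 9 => 1 | 10 => 1 | 11 => 3*z | _ => 0

theorem nn_univ {z : ℕ} (k : ℕ) : nn k (Finset.univ : Finset (Job z)) = tot z k := by
  unfold nn
  rw [job_sum]
  simp only [tg]
  rcases k with _|_|_|_|_|_|_|_|_|_|_|_|k <;> simp [tot]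

theorem cg_aux (z : ℕ) : ∑ i : Fin (z+1), (z + i.val) + ∑ i : Fin z, (3*z - (i.val+1)) = z + 4*z*z := by
  rw [Fin.sum_univ_succ, add_assoc, ← Finset.sum_add_distrib]
  have : ∀ i : Fin z, (z + i.succ.val) + (3*z - (i.val+1)) = 4*z := by
    intro i; have := i.2; simp only [Fin.val_succ]; omega
  simp only [this]
  simp; ring

theorem cg_tot (z : ℕ) : 2 * ∑ j : Job z, cv j + ∑ j : Job z, gd j = 2*(z + 4*z*z) := by
  rw [job_sum, job_sum]
  simp only [cv, gd]
  have := cg_aux z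
  simp only [Finset.sum_const_zero]
  omega

theorem io_tot {z : ℕ} (ι : Fin (3*z) → ℕ) : ∑ j : Job z, io ι j = ∑ i, ι i := by
  rw [job_sum]
  simp [io]

theorem area (z D : ℕ) (ι : Fin (3*z) → ℕ) (hz : 0 < z) (hD : 0 < D) (hsum : ∑ i, ι i = z * D) :
    ∑ j, qJob z j * pJob z D ι j = 4 * Wval z D := by
  have h7 : ∑ i : Fin z, (D^5 + (3*z - (i.val+1))*D^7 - D) + z * D =
      z * D^5 + (∑ i : Fin z, (3*z - (i.val+1)))*D^7 := by
    have : D ≤ D^5 := Nat.le_self_pow (by norm_num) D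
    have e : ∑ i : Fin z, (D^5 + (3*z - (i.val+1))*D^7 - D) + ∑ i : Fin z, D =
      ∑ i : Fin z, (D^5 + (3*z - (i.val+1))*D^7) := by
      rw [← Finset.sum_add_distrib]
      apply Finset.sum_congr rfl
      intro i _
      omega
    simp [Finset.sum_add_distrib, Finset.sum_mul] at e ⊢
    exact e
  have h := cg_aux z
  rw [job_sum]
  simp only [qJob, pJob, one_mul, hsum, Wval]
  simp only [Finset.sum_const, Finset.card_univ, Fintype.card_fin, smul_eq_mul, Finset.sum_add_distrib,
    ← Finset.mul_sum, ← Finset.sum_mul] at h h7 ⊢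
  obtain ⟨w, hw⟩ : ∃ w, 4*z = w+1 := ⟨4*z-1, by omega⟩
  have hw' : 4*z-1 = w := by omega
  rw [hw']
  generalize ∑ i : Fin z, (D^5 + (3*z - (i.val+1))*D^7 - D) = G at *
  generalize ∑ i : Fin z, (3*z - (i.val+1)) = G' at *
  generalize ∑ i : Fin (z+1), i.val = C at *
  zify at *
  have hG : (G:ℤ) = z * D^5 + G'*D^7 - z * D := by linarith
  have hC : (C:ℤ) = z + 4*z*z - G' - (z+1)*z := by linarith
  have hW : (w:ℤ) = 4*z-1 := by linarith
  rw [hG, hC, hW]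
  ring

theorem dstep {D u v u' v' : ℤ} (h : u + D * v = u' + D * v') (h1 : |u - u'| < D) :
    u = u' ∧ v = v' := by
  have hD : 0 < D := lt_of_le_of_lt (abs_nonneg _) h1
  have h2 : u - u' = D * (v' - v) := by linarith
  have h3 : D ∣ u - u' := ⟨_, h2⟩
  have h4 : u - u' = 0 := Int.eq_zero_of_abs_lt_dvd h3 h1
  constructor
  · linarith
  · rw [h4] at h2
    rcases mul_eq_zero.mp h2.symm with h | h <;> linarith

theorem duniq (D : ℕ) (g g' s s' a2 a3 a4 a5 a6 a7 a8 b2 b3 b4 b5 b6 b7 b8 w z : ℕ)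
    (hg : g ≤ z) (hg' : g' ≤ z) (hs : s ≤ z * D) (hs' : s' ≤ z * D) (hz : 2 * z < D)
    (ha2 : a2 < D) (ha3 : a3 < D) (ha4 : a4 < D) (ha5 : a5 < D) (ha6 : a6 < D) (ha7 : a7 < D)
    (hb2 : b2 < D) (hb3 : b3 < D) (hb4 : b4 < D) (hb5 : b5 < D) (hb6 : b6 < D) (hb7 : b7 < D)
    (ha : w + g * D = s + a2*D^2+a3*D^3+a4*D^4+a5*D^5+a6*D^6+a7*D^7+a8*D^8)
    (hb : w + g' * D = s' + b2*D^2+b3*D^3+b4*D^4+b5*D^5+b6*D^6+b7*D^7+b8*D^8) :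
    s + g' * D = s' + g * D ∧ a2 = b2 ∧ a3 = b3 ∧ a4 = b4 ∧ a5 = b5 ∧ a6 = b6 ∧ a7 = b7 ∧ a8 = b8 := by
  have ab : ∀ {a b : ℕ}, a < D → b < D → |(a:ℤ) - b| < D := by
    intro a b h1 h2
    rw [abs_lt]; constructor <;> omega
  have hgD : g * D ≤ z * D := Nat.mul_le_mul_right _ hg
  have hgD' : g' * D ≤ z * D := Nat.mul_le_mul_right _ hg'
  have hzD : 2 * (z * D) < D * D := by nlinarith
  have e : ((s:ℤ) - g * D) + (D:ℤ)^2 * (a2 + D * (a3 + D * (a4 + D * (a5 + D * (a6 + D * (a7 + D * a8))))))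
     = ((s':ℤ) - g' * D) + (D:ℤ)^2 * (b2 + D * (b3 + D * (b4 + D * (b5 + D * (b6 + D * (b7 + D * b8)))))) := by
    zify at ha hb
    linear_combination hb - ha
  have hl : |((s:ℤ) - g * D) - ((s':ℤ) - g' * D)| < (D:ℤ)^2 := by
    zify at *
    rw [abs_lt, pow_two]
    have : (0:ℤ) ≤ g * D := by positivity
    have : (0:ℤ) ≤ g' * D := by positivity
    constructor <;> linarith
  obtain ⟨e1, e⟩ := dstep e hl
  obtain ⟨e2, e⟩ := dstep e (ab ha2 hb2)
  obtain ⟨e3, e⟩ := dstep e (ab ha3 hb3)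
  obtain ⟨e4, e⟩ := dstep e (ab ha4 hb4)
  obtain ⟨e5, e⟩ := dstep e (ab ha5 hb5)
  obtain ⟨e6, e⟩ := dstep e (ab ha6 hb6)
  obtain ⟨e7, e⟩ := dstep e (ab ha7 hb7)
  refine ⟨?_, ?_, ?_, ?_, ?_, ?_, ?_, ?_⟩
  · zify; linarith
  all_goals assumption_mod_cast

theorem nn_mono {z : ℕ} (k : ℕ) {S T : Finset (Job z)} (h : S ⊆ T) : nn k S ≤ nn k T :=
  Finset.sum_le_sum_of_subset h

theorem nn_le {z : ℕ} (k : ℕ) (S : Finset (Job z)) : nn k S ≤ tot z k := by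
  rw [← nn_univ]; exact nn_mono k (Finset.subset_univ _)

theorem d7_le {z : ℕ} (S : Finset (Job z)) : d7 S ≤ 22*z*z+5*z := by
  unfold d7
  have h2 := nn_le 2 S
  have h3 := nn_le 3 S
  have h5 := nn_le 5 S
  have h6 := nn_le 6 S
  have h9 := nn_le 9 S
  have h10 := nn_le 10 S
  have hc : ∑ j ∈ S, cv j ≤ ∑ j : Job z, cv j := Finset.sum_le_sum_of_subset (Finset.subset_univ _)
  have hg : ∑ j ∈ S, gd j ≤ ∑ j : Job z, gd j := Finset.sum_le_sum_of_subset (Finset.subset_univ _)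
  have h := cg_tot z
  simp only [tot] at *
  have := Nat.mul_le_mul_left (3*z) (Nat.add_le_add h2 h3)
  have := Nat.mul_le_mul_left (4*z) h5
  have := Nat.mul_le_mul (show 4*z-1 ≤ 4*z by omega) h6
  have := Nat.mul_le_mul_left z h9
  have := Nat.mul_le_mul_left (2*z) h10
  have e1 : 3*z*(z+z) = 6*(z*z) := by ring
  have e2 : 4*z*z = 4*(z*z) := by ring
  have e3 : 22*z*z = 22*(z*z) := by ring
  generalize (4*z-1) * nn 6 S = X at *
  generalize 3*z*(nn 2 S + nn 3 S) = X2 at *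
  generalize 4*z*nn 5 S = X3 at *
  generalize z*nn 9 S = X4 at *
  generalize 2*z*nn 10 S = X5 at *
  omega

theorem digits_eq (z D : ℕ) (ι : Fin (3*z) → ℕ) (hz : 0 < z) (hsum : ∑ i, ι i = z * D)
    (hD : 4*z*(7*z+1) < D) (S T : Finset (Job z))
    (h : ∑ j ∈ S, pJob z D ι j = ∑ j ∈ T, pJob z D ι j) :
    ∑ j ∈ S, io ι j + nn 7 T * D = ∑ j ∈ T, io ι j + nn 7 S * D ∧
    nn 0 S + nn 6 S + nn 10 S = nn 0 T + nn 6 T + nn 10 T ∧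
    nn 1 S + nn 5 S + nn 9 S = nn 1 T + nn 5 T + nn 9 T ∧
    nn 2 S + nn 6 S + nn 8 S = nn 2 T + nn 6 T + nn 8 T ∧
    nn 3 S + nn 7 S + nn 5 S = nn 3 T + nn 7 T + nn 5 T ∧
    nn 2 S + nn 3 S = nn 2 T + nn 3 T ∧ d7 S = d7 T ∧
    nn 4 S + nn 5 S + nn 6 S + nn 9 S + nn 10 S = nn 4 T + nn 5 T + nn 6 T + nn 9 T + nn 10 T := by
  have hD' : 28 * z * z + 4 * z < D := by nlinarith
  have hzz : z ≤ z * z := by nlinarith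
  have hzz' : 28 * z * z = 28 * (z*z) := by ring
  have hzz'' : 22 * z * z = 22 * (z*z) := by ring
  have hDp : 0 < D := by omega
  have hS := sum_digits z D ι hDp S
  have hT := sum_digits z D ι hDp T
  rw [h] at hS
  have io_le : ∀ S : Finset (Job z), ∑ j ∈ S, io ι j ≤ z * D := by
    intro S
    rw [← hsum, ← io_tot]
    exact Finset.sum_le_sum_of_subset (Finset.subset_univ _)
  have n : ∀ k (S : Finset (Job z)), nn k S ≤ tot z k := fun k S => nn_le k S
  have b : ∀ S : Finset (Job z), nn 0 S ≤ z+1 ∧ nn 1 S ≤ z+1 ∧ nn 2 S ≤ z ∧ nn 3 S ≤ z ∧ nn 5 S ≤ z ∧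
    nn 6 S ≤ z ∧ nn 7 S ≤ z ∧ nn 8 S ≤ z ∧ nn 9 S ≤ 1 ∧ nn 10 S ≤ 1 := fun S =>
    ⟨n 0 S, n 1 S, n 2 S, n 3 S, n 5 S, n 6 S, n 7 S, n 8 S, n 9 S, n 10 S⟩
  obtain ⟨a0, a1, a2, a3, a5, a6, a7, a8, a9, a10⟩ := b S
  obtain ⟨b0, b1, b2, b3, b5, b6, b7, b8, b9, b10⟩ := b T
  have s7 := d7_le S
  have t7 := d7_le T
  exact duniq D _ _ _ _ _ _ _ _ _ _ _ _ _ _ _ _ _ _ _ z a7 b7 (io_le S) (io_le T) (by omega)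
    (by omega) (by omega) (by omega) (by omega) (by omega) (by omega)
    (by omega) (by omega) (by omega) (by omega) (by omega) (by omega) hS hT

theorem digits_W (z D : ℕ) (ι : Fin (3*z) → ℕ) (hz : 0 < z) (hsum : ∑ i, ι i = z * D)
    (hD : 4*z*(7*z+1) < D) (S : Finset (Job z))
    (h : ∑ j ∈ S, pJob z D ι j = Wval z D) :
    ∑ j ∈ S, io ι j = nn 7 S * D ∧
    nn 0 S + nn 6 S + nn 10 S = z + 1 ∧
    nn 1 S + nn 5 S + nn 9 S = z + 1 ∧
    nn 2 S + nn 6 S + nn 8 S = z ∧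
    nn 3 S + nn 7 S + nn 5 S = z ∧
    nn 2 S + nn 3 S = z ∧ d7 S = z*(7*z+1) ∧
    nn 4 S + nn 5 S + nn 6 S + nn 9 S + nn 10 S = z + 1 := by
  have hD' : 28 * z * z + 4 * z < D := by nlinarith
  have hzz : z ≤ z * z := by nlinarith
  have hzz' : 28 * z * z = 28 * (z*z) := by ring
  have hzz'' : 22 * z * z = 22 * (z*z) := by ring
  have hzz3 : z*(7*z+1) = 7 * (z*z) + z := by ring
  have hDp : 0 < D := by omega
  have hS := sum_digits z D ι hDp S
  rw [h] at hS
  have hT : Wval z D + 0 * D = 0 + (z+1) * D^2 + (z+1)*D^3 + z*D^4+z*D^5+z*D^6+z*(7*z+1)*D^7+(z+1)*D^8 := by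
    unfold Wval; ring
  have io_le : ∀ S : Finset (Job z), ∑ j ∈ S, io ι j ≤ z * D := by
    intro S
    rw [← hsum, ← io_tot]
    exact Finset.sum_le_sum_of_subset (Finset.subset_univ _)
  have n : ∀ k (S : Finset (Job z)), nn k S ≤ tot z k := fun k S => nn_le k S
  have b : ∀ S : Finset (Job z), nn 0 S ≤ z+1 ∧ nn 1 S ≤ z+1 ∧ nn 2 S ≤ z ∧ nn 3 S ≤ z ∧ nn 5 S ≤ z ∧
    nn 6 S ≤ z ∧ nn 7 S ≤ z ∧ nn 8 S ≤ z ∧ nn 9 S ≤ 1 ∧ nn 10 S ≤ 1 := fun S =>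
    ⟨n 0 S, n 1 S, n 2 S, n 3 S, n 5 S, n 6 S, n 7 S, n 8 S, n 9 S, n 10 S⟩
  obtain ⟨a0, a1, a2, a3, a5, a6, a7, a8, a9, a10⟩ := b S
  have s7 := d7_le S
  have := duniq D _ _ _ _ _ _ _ _ _ _ _ _ _ _ _ _ _ _ _ z a7 (Nat.zero_le _) (io_le S) (Nat.zero_le _) (by omega)
    (by omega) (by omega) (by omega) (by omega) (by omega) (by omega)
    (by omega) (by omega) (by omega) (by omega) (by omega) (by omega) hS hT
  simpa using this

theorem interval_sum {J : Type} (S : Finset J) (x p : J → ℕ) (a b : ℕ)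
    (hin : ∀ j ∈ S, a ≤ x j ∧ x j + p j ≤ b)
    (hd : ∀ i ∈ S, ∀ j ∈ S, i ≠ j → x i + p i ≤ x j ∨ x j + p j ≤ x i) :
    ∑ j ∈ S, p j ≤ b - a := by
  have h1 : (S.biUnion fun j => Finset.Ico (x j) (x j + p j)).card = ∑ j ∈ S, p j := by
    rw [Finset.card_biUnion]
    · simp
    · intro i hi j hj hij
      rw [Function.onFun, Finset.disjoint_left]
      intro t ht ht'
      simp only [Finset.mem_Ico] at ht ht'
      rcases hd i hi j hj hij with h | h <;> omega
  rw [← h1, ← Nat.card_Ico]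
  apply Finset.card_le_card
  intro t ht
  simp only [Finset.mem_biUnion, Finset.mem_Ico] at ht ⊢
  obtain ⟨j, hj, h⟩ := ht
  have := hin j hj
  omega

def RT {z : ℕ} (x y : Job z → ℕ) (r t : ℕ) : Finset (Job z) :=
  Finset.univ.filter (fun j => x j < t ∧ y j ≤ r ∧ r < y j + qJob z j)

def Bf {z : ℕ} (x : Job z → ℕ) (t : ℕ) : Finset (Job z) :=
  Finset.univ.filter (fun j => x j < t)

def Bd {z : ℕ} (W : ℕ) (x y : Job z → ℕ) (r t : ℕ) : Prop :=
  t = W ∨ ∃ e, x e = t ∧ y e ≤ r ∧ r < y e + qJob z e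

theorem p_pos (z D : ℕ) (ι : Fin (3*z) → ℕ) (hD : 1 < D) (hι : ∀ i, 0 < ι i) (j : Job z) :
    0 < pJob z D ι j := by
  cases j with
  | Jγ j =>
    simp only [pJob]
    have : D^1 < D^5 := Nat.pow_lt_pow_right hD (by norm_num)
    rw [pow_one] at this
    omega
  | Jpart i => exact hι i
  | _ => simp only [pJob]; positivity

section
variable {z D : ℕ} {ι : Fin (3*z) → ℕ} {x y : Job z → ℕ}

theorem row_disj (hF : PackFeasible (Wval z D) (pJob z D ι) (qJob z) x y) {r : ℕ} {i j : Job z}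
    (hi : y i ≤ r ∧ r < y i + qJob z i) (hj : y j ≤ r ∧ r < y j + qJob z j) (hij : i ≠ j) :
    x i + pJob z D ι i ≤ x j ∨ x j + pJob z D ι j ≤ x i := by
  rcases hF.2 i j hij with h | h | h | h
  · exact Or.inl h
  · exact Or.inr h
  · omega
  · omega

theorem row_le (hF : PackFeasible (Wval z D) (pJob z D ι) (qJob z) x y) (r : ℕ) :
    ∑ j ∈ RT x y r (Wval z D), pJob z D ι j ≤ Wval z D := by
  have := interval_sum (RT x y r (Wval z D)) x (pJob z D ι) 0 (Wval z D)
    (fun j _ => ⟨Nat.zero_le _, hF.1 j⟩)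
    (fun i hi j hj hij => row_disj hF (r := r)
      (by simp [RT] at hi; exact hi.2) (by simp [RT] at hj; exact hj.2) hij)
  simpa using this

theorem rows_sum (hy : ∀ j, y j + qJob z j ≤ 4) (t : ℕ) (hx : ∀ j, x j < t) (f : Job z → ℕ) :
    ∑ j ∈ RT x y 0 t, f j + ∑ j ∈ RT x y 1 t, f j + ∑ j ∈ RT x y 2 t, f j + ∑ j ∈ RT x y 3 t, f j
      = ∑ j, qJob z j * f j := by
  simp only [RT, Finset.sum_filter, ← Finset.sum_add_distrib]
  apply Finset.sum_congr rfl
  intro j _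
  have h1 := hy j
  have h2 := hx j
  have h3 : qJob z j = 1 ∨ qJob z j = 2 ∨ qJob z j = 3 := by cases j <;> simp [qJob]
  have h4 : y j = 0 ∨ y j = 1 ∨ y j = 2 ∨ y j = 3 := by omega
  rcases h3 with h3 | h3 | h3 <;> rcases h4 with h4 | h4 | h4 | h4 <;>
    first
    | omega
    | (simp [h2, h3, h4]; try ring)

theorem row_full (hz : 0 < z) (hD : 1 < D) (hι : ∀ i, 0 < ι i) (hsum : ∑ i, ι i = z * D)
    (hF : PackFeasible (Wval z D) (pJob z D ι) (qJob z) x y)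
    (hy : ∀ j, y j + qJob z j ≤ 4) {r : ℕ} (hr : r < 4) :
    ∑ j ∈ RT x y r (Wval z D), pJob z D ι j = Wval z D := by
  have hx : ∀ j, x j < Wval z D := fun j => by
    have := hF.1 j
    have := p_pos z D ι hD hι j
    omega
  have h := rows_sum hy (Wval z D) hx (pJob z D ι)
  rw [area z D ι hz (by omega) hsum] at h
  have h0 := row_le hF 0
  have h1 := row_le hF 1
  have h2 := row_le hF 2
  have h3 := row_le hF 3
  interval_cases r <;> omega

theorem row_t (hz : 0 < z) (hD : 1 < D) (hι : ∀ i, 0 < ι i) (hsum : ∑ i, ι i = z * D)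
    (hF : PackFeasible (Wval z D) (pJob z D ι) (qJob z) x y)
    (hy : ∀ j, y j + qJob z j ≤ 4) {r t : ℕ} (hr : r < 4) (ht : Bd (Wval z D) x y r t) :
    ∑ j ∈ RT x y r t, pJob z D ι j = t := by
  have hfull := row_full hz hD hι hsum hF hy hr
  rcases ht with rfl | ⟨e, rfl, he⟩
  · exact hfull
  have hpe := p_pos z D ι hD hι e
  have hFe := hF.1 e
  have hs : ∑ j ∈ RT x y r (Wval z D), pJob z D ι j = ∑ j ∈ RT x y r (x e), pJob z D ι j
     + ∑ j ∈ (RT x y r (Wval z D)).filter (fun j => ¬ x j < x e), pJob z D ι j := by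
    rw [← Finset.sum_filter_add_sum_filter_not (RT x y r (Wval z D)) (fun j => x j < x e)]
    congr 2
    ext j
    simp only [RT, Finset.mem_filter, Finset.mem_univ, true_and]
    constructor
    · rintro ⟨⟨_, h⟩, h'⟩; exact ⟨h', h⟩
    · rintro ⟨h', h⟩; exact ⟨⟨by omega, h⟩, h'⟩
  have h1 := interval_sum (RT x y r (x e)) x (pJob z D ι) 0 (x e)
    (fun j hj => by
      simp only [RT, Finset.mem_filter, Finset.mem_univ, true_and] at hj
      refine ⟨Nat.zero_le _, ?_⟩
      rcases row_disj hF hj.2 he (by rintro rfl; omega) with h | h <;> omega)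
    (fun i hi j hj hij => row_disj hF (r := r)
      (by simp [RT] at hi; exact hi.2) (by simp [RT] at hj; exact hj.2) hij)
  have h2 := interval_sum ((RT x y r (Wval z D)).filter (fun j => ¬ x j < x e)) x (pJob z D ι)
    (x e) (Wval z D)
    (fun j hj => by
      simp only [RT, Finset.mem_filter, Finset.mem_univ, true_and] at hj
      exact ⟨by omega, hF.1 j⟩)
    (fun i hi j hj hij => row_disj hF (r := r)
      (by simp [RT] at hi; exact hi.1.2) (by simp [RT] at hj; exact hj.1.2) hij)
  omega

theorem xne (hD : 1 < D) (hι : ∀ i, 0 < ι i)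
    (hF : PackFeasible (Wval z D) (pJob z D ι) (qJob z) x y) {r : ℕ} {i j : Job z}
    (hi : y i ≤ r ∧ r < y i + qJob z i) (hj : y j ≤ r ∧ r < y j + qJob z j) (hij : i ≠ j) :
    x i ≠ x j := by
  have := p_pos z D ι hD hι i
  have := p_pos z D ι hD hι j
  rcases row_disj hF hi hj hij with h | h <;> omega

theorem nn_card (k : ℕ) (S : Finset (Job z)) : nn k S = (S.filter (fun j => tg j = k)).card := by
  unfold nn; rw [Finset.card_filter]

theorem nn_zero {k : ℕ} {S : Finset (Job z)} (h : nn k S = 0) {j : Job z} (hj : tg j = k) : j ∉ S := by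
  rw [nn_card, Finset.card_eq_zero, Finset.filter_eq_empty_iff] at h
  exact fun hS => h hS hj

theorem nn_zero' {k : ℕ} {S : Finset (Job z)} (h : ∀ j, tg j = k → j ∉ S) : nn k S = 0 := by
  rw [nn_card, Finset.card_eq_zero, Finset.filter_eq_empty_iff]
  exact fun j hS hj => h j hj hS

theorem nn_all {k : ℕ} {S : Finset (Job z)} (h : nn k S = tot z k) {j : Job z} (hj : tg j = k) :
    j ∈ S := by
  rw [← nn_univ, nn_card, nn_card] at h
  have : S.filter (fun j => tg j = k) = Finset.univ.filter (fun j => tg j = k) :=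
    Finset.eq_of_subset_of_card_le (Finset.filter_subset_filter _ (Finset.subset_univ _)) h.ge
  have hm : j ∈ S.filter (fun j => tg j = k) := by rw [this]; simp [hj]
  exact (Finset.mem_filter.mp hm).1

theorem nn_all' {k : ℕ} {S : Finset (Job z)} (h : ∀ j, tg j = k → j ∈ S) : nn k S = tot z k := by
  rw [← nn_univ, nn_card, nn_card]
  congr 1
  ext j
  simp only [Finset.mem_filter, Finset.mem_univ, true_and]
  exact ⟨fun h => h.2, fun hj => ⟨h j hj, hj⟩⟩

def qT : ℕ → ℕ
  | 0 => 3 | 1 => 3 | 2 => 2 | 3 => 2 | 4 => 2 | _ => 1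

def yT : ℕ → ℕ
  | 0 => 0 | 1 => 1 | 2 => 0 | 3 => 2 | 4 => 1 | 5 => 0 | 6 => 3 | 7 => 1 | 8 => 2
  | 9 => 0 | 10 => 3 | _ => 1

theorem q_tag (j : Job z) : qJob z j = qT (tg j) := by cases j <;> rfl

theorem tg_l1 {j : Job z} (h : tg j = 9) : j = .Jl1 := by cases j <;> simp_all [tg]

theorem mid_facts (hz : 0 < z) (hDb : 4*z*(7*z+1) < D) (hι : ∀ i, 0 < ι i) (hsum : ∑ i, ι i = z * D)
    (hF : PackFeasible (Wval z D) (pJob z D ι) (qJob z) x y)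
    (hy : ∀ j, y j + qJob z j ≤ 4) {r : ℕ} (hr : r = 1 ∨ r = 2) :
    nn 5 (RT x y r (Wval z D)) = 0 ∧ nn 6 (RT x y r (Wval z D)) = 0 ∧
    nn 9 (RT x y r (Wval z D)) = 0 ∧ nn 10 (RT x y r (Wval z D)) = 0 ∧
    nn 4 (RT x y r (Wval z D)) = z + 1 := by
  have hD : 1 < D := by nlinarith
  have hx : ∀ j, x j < Wval z D := fun j => by
    have := hF.1 j
    have := p_pos z D ι hD hι j
    omega
  obtain ⟨_, e2, e3, e4, e5, e6, e7, e8⟩ := digits_W z D ι hz hsum hDb _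
    (row_full hz hD hι hsum hF hy (r := r) (by omega))
  have h0 : nn 0 (RT x y r (Wval z D)) = z + 1 := nn_all' (k := 0) (by
    intro j hj
    have h1 := hy j
    have h2 := q_tag j
    rw [hj] at h2
    simp only [qT] at h2
    simp only [RT, Finset.mem_filter, Finset.mem_univ, true_and]
    exact ⟨hx j, by omega, by omega⟩)
  have h1 : nn 1 (RT x y r (Wval z D)) = z + 1 := nn_all' (k := 1) (by
    intro j hj
    have h1 := hy j
    have h2 := q_tag j
    rw [hj] at h2
    simp only [qT] at h2
    simp only [RT, Finset.mem_filter, Finset.mem_univ, true_and]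
    exact ⟨hx j, by omega, by omega⟩)
  omega

theorem cv_zero {S : Finset (Job z)} (h : nn 4 S = 0) : ∑ j ∈ S, cv j = 0 := by
  apply Finset.sum_eq_zero
  intro j hj
  cases j with
  | Jc i => exact absurd hj (nn_zero h rfl)
  | _ => rfl

theorem gd_lb (S : Finset (Job z)) : 2 * z * (nn 7 S + nn 8 S) ≤ ∑ j ∈ S, gd j := by
  simp only [nn, ← Finset.sum_add_distrib, Finset.mul_sum]
  apply Finset.sum_le_sum
  intro j _
  cases j with
  | Jγ i => have := i.2; simp [tg, gd]; omega
  | Jδ i => have := i.2; simp [tg, gd]; omega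
  | _ => simp [tg, gd]

theorem gd_zero {S : Finset (Job z)} (h : nn 7 S = 0) (h' : nn 8 S = 0) : ∑ j ∈ S, gd j = 0 := by
  apply Finset.sum_eq_zero
  intro j hj
  cases j with
  | Jγ i => exact absurd hj (nn_zero h rfl)
  | Jδ i => exact absurd hj (nn_zero h' rfl)
  | _ => rfl

theorem io_all {S : Finset (Job z)} (hι : ∀ i, 0 < ι i) (h : ∑ j ∈ S, io ι j = ∑ j, io ι j)
    {j : Job z} (hj : tg j = 11) : j ∈ S := by
  by_contra hn
  have hlt : ∑ j ∈ S, io ι j < ∑ j, io ι j := by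
    apply Finset.sum_lt_sum_of_subset (Finset.subset_univ S) (Finset.mem_univ j) hn
    · cases j with
      | Jpart i => exact hι i
      | _ => simp [tg] at hj
    · intros; exact Nat.zero_le _
  omega

theorem num1 (z u v cc g : ℕ) (hz : 0 < z)
    (h : 3*z*z + 4*z*u + (4*z-1)*v + z*0 + 2*z*0 + cc + g = z*(7*z+1)) (huv : u + v = z + 1) :
    False := by
  obtain ⟨w, hw⟩ : ∃ w, 4*z = w+1 := ⟨4*z-1, by omega⟩
  have hw' : 4*z-1 = w := by omega
  rw [hw', hw] at h
  zify at *
  have hww : (w:ℤ) = 4*z-1 := by linarith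
  have hv : (v:ℤ) = z + 1 - u := by linarith
  rw [hww, hv] at h
  nlinarith

theorem num2 (z u v g : ℕ) (hz : 0 < z)
    (h : 3*z*z + 4*z*u + (4*z-1)*v + z*1 + 2*z*0 + 0 + g = z*(7*z+1)) (huv : u + v = z) :
    g = v := by
  obtain ⟨w, hw⟩ : ∃ w, 4*z = w+1 := ⟨4*z-1, by omega⟩
  have hw' : 4*z-1 = w := by omega
  rw [hw', hw] at h
  zify at *
  have hww : (w:ℤ) = 4*z-1 := by linarith
  have hv : (u:ℤ) = z - v := by linarith
  rw [hww, hv] at h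
  linarith

theorem num3 (z a b c d e f g i j : ℕ) {k : ℕ} (h6 : f = 0) (h9 : j = 1) (h10 : k = 0) (h78 : g + i = 0)
    (q2 : a + f + k = z + 1) (q3 : b + e + j = z + 1) (q4 : c + f + i = z) (q5 : d + g + e = z)
    (q6 : c + d = z) (hab : e + f = z) : e = z ∧ d = 0 ∧ c = z ∧ a = z + 1 ∧ b = 0 := by omega

theorem num4 {z a b : ℕ} (h : a = z) (h' : a + b = z) : b = 0 := by omega

theorem num5 {z a b c : ℕ} (h : a = 0) (h2 : c = 0) (h' : a + b + c = z) : b = z := by omega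

theorem num6 {z a b c : ℕ} (h : a = 0) (h2 : b = 0) (h' : a + b + c = z) : c = z := by omega

theorem l2_rows (hy : ∀ j, y j + qJob z j ≤ 4) (t : ℕ) (hx : ∀ j, x j < t) :
    nn 10 (RT x y 0 t) + nn 10 (RT x y 1 t) + nn 10 (RT x y 2 t) + nn 10 (RT x y 3 t) = 1 := by
  have l2 := rows_sum hy t hx (fun j => if tg j = 10 then 1 else 0)
  have l2' : ∑ j : Job z, qJob z j * (if tg j = 10 then 1 else 0) = 1 := by
    refine Eq.trans ?_ (show nn 10 (Finset.univ : Finset (Job z)) = 1 from nn_univ 10)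
    apply Finset.sum_congr rfl
    intro j _
    rw [q_tag]
    split_ifs with h
    · rw [h]; rfl
    · rfl
  rw [l2'] at l2
  change nn 10 (RT x y 0 t) + nn 10 (RT x y 1 t) + nn 10 (RT x y 2 t)
    + nn 10 (RT x y 3 t) = 1 at l2
  exact l2

attribute [local irreducible] nn

set_option maxHeartbeats 1000000 in
theorem normal_form (hz : 0 < z) (hDb : 4*z*(7*z+1) < D) (hι : ∀ i, 0 < ι i) (hsum : ∑ i, ι i = z * D)
    (hF : PackFeasible (Wval z D) (pJob z D ι) (qJob z) x y)
    (hy : ∀ j, y j + qJob z j ≤ 4) (hl : y .Jl1 = 0) : ∀ j, y j = yT (tg j) := by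
  have hD : 1 < D := by nlinarith
  have hx : ∀ j, x j < Wval z D := fun j => by
    have := hF.1 j
    have := p_pos z D ι hD hι j
    omega
  have hd := fun r (hr : r < 4) => digits_W z D ι hz hsum hDb _
    (row_full hz hD hι hsum hF hy (r := r) hr)
  have hq : ∀ j k, tg j = k → y j + qT k ≤ 4 := by
    intro j k hk
    have := hy j
    rw [q_tag, hk] at this
    exact this
  have hmem : ∀ {j r}, j ∈ RT x y r (Wval z D) ↔ y j ≤ r ∧ r < y j + qT (tg j) := by
    intro j r
    simp only [RT, Finset.mem_filter, Finset.mem_univ, true_and, hx j, q_tag]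
  obtain ⟨m15, m16, m19, m110, m14⟩ := mid_facts hz hDb hι hsum hF hy (r := 1) (by simp)
  obtain ⟨m25, m26, m29, m210, m24⟩ := mid_facts hz hDb hι hsum hF hy (r := 2) (by simp)
  have yc : ∀ j, tg j = 4 → y j = 1 := by
    intro j hj
    have h1 := hmem.mp (nn_all (k := 4) m14 hj)
    have h2 := hmem.mp (nn_all (k := 4) m24 hj)
    rw [hj] at h1 h2
    simp only [qT] at h1 h2
    omega
  have c0 : nn 4 (RT x y 0 (Wval z D)) = 0 := nn_zero' (fun j hj => by
    rw [hmem, yc j hj]; omega)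
  have c3 : nn 4 (RT x y 3 (Wval z D)) = 0 := nn_zero' (fun j hj => by
    rw [hmem, yc j hj, hj]; simp [qT])
  have l10 : nn 9 (RT x y 0 (Wval z D)) = 1 := nn_all' (k := 9) (fun j hj => by
    rw [hmem, hj, tg_l1 hj, hl]; simp [qT])
  have l13 : nn 9 (RT x y 3 (Wval z D)) = 0 := nn_zero' (k := 9) (fun j hj => by
    rw [hmem, hj, tg_l1 hj, hl]; simp [qT])
  have l2 := l2_rows hy (Wval z D) hx
  obtain ⟨p1, p2, p3, p4, p5, p6, p7, p8⟩ := hd 3 (by norm_num)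
  have l23 : nn 10 (RT x y 3 (Wval z D)) = 1 := by
    by_contra hne
    have h0 : nn 10 (RT x y 3 (Wval z D)) = 0 := by omega
    unfold d7 at p7
    rw [p6, l13, h0] at p7
    exact num1 z _ _ _ _ hz p7 (by omega)
  have l20 : nn 10 (RT x y 0 (Wval z D)) = 0 := by omega
  obtain ⟨q1, q2, q3, q4, q5, q6, q7, q8⟩ := hd 0 (by norm_num)
  have hgl := gd_lb (RT x y 0 (Wval z D))
  unfold d7 at q7
  rw [q6, l10, l20, cv_zero c0] at q7
  have hab : nn 5 (RT x y 0 (Wval z D)) + nn 6 (RT x y 0 (Wval z D)) = z := by omega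
  have hgb : ∑ j ∈ RT x y 0 (Wval z D), gd j = nn 6 (RT x y 0 (Wval z D)) :=
    num2 z _ _ _ hz q7 hab
  have h78 : nn 7 (RT x y 0 (Wval z D)) + nn 8 (RT x y 0 (Wval z D)) = 0 := by
    by_contra hne
    have : 1 ≤ nn 7 (RT x y 0 (Wval z D)) + nn 8 (RT x y 0 (Wval z D)) := by omega
    have := Nat.mul_le_mul_left (2*z) this
    omega
  have h60 : nn 6 (RT x y 0 (Wval z D)) = 0 := by
    rw [← hgb]; exact gd_zero (by omega) (by omega)
  obtain ⟨h50, h30, h20, h00, h10⟩ := num3 z _ _ _ _ _ _ _ _ _ h60 l10 l20 h78 q2 q3 q4 q5 q6 hab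
  clear p1 p2 p3 p4 p5 p6 p7 p8 q1 q2 q3 q4 q5 q6 q7 q8 hgl hgb hab hDb h78 l2
  have yA : ∀ j, tg j = 0 → y j = 0 := fun j hj => by
    have h1 := hmem.mp (nn_all (k := 0) h00 hj); omega
  have ya : ∀ j, tg j = 2 → y j = 0 := fun j hj => by
    have h1 := hmem.mp (nn_all (k := 2) h20 hj); omega
  have yα : ∀ j, tg j = 5 → y j = 0 := fun j hj => by
    have h1 := hmem.mp (nn_all (k := 5) h50 hj); omega
  have yB : ∀ j, tg j = 1 → y j = 1 := fun j hj => by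
    have h1 := nn_zero h10 hj
    have h2 := hq j 1 hj
    rw [hmem, hj] at h1
    simp only [qT] at h1 h2
    omega
  obtain ⟨r1, -, -, -, r5, r6, -, -⟩ := hd 1 (by norm_num)
  obtain ⟨-, -, -, s4, -, -, -, -⟩ := hd 2 (by norm_num)
  have h21 : nn 2 (RT x y 1 (Wval z D)) = z := nn_all' (k := 2) (fun j hj => by
    rw [hmem, ya j hj, hj]; simp [qT])
  have h22 : nn 2 (RT x y 2 (Wval z D)) = 0 := nn_zero' (k := 2) (fun j hj => by
    rw [hmem, ya j hj, hj]; simp [qT])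
  have h31 : nn 3 (RT x y 1 (Wval z D)) = 0 := num4 h21 r6
  have yb : ∀ j, tg j = 3 → y j = 2 := fun j hj => by
    have h1 := nn_zero h30 hj
    have h2 := nn_zero h31 hj
    have h3 := hq j 3 hj
    rw [hmem, hj] at h1 h2
    simp only [qT] at h1 h2 h3
    omega
  have yβ : ∀ j, tg j = 6 → y j = 3 := fun j hj => by
    have h1 := nn_zero h60 hj
    have h2 := nn_zero m16 hj
    have h3 := nn_zero m26 hj
    have h4 := hq j 6 hj
    rw [hmem, hj] at h1 h2 h3
    simp only [qT] at h1 h2 h3 h4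
    omega
  have h71 : nn 7 (RT x y 1 (Wval z D)) = z := num5 h31 m15 r5
  have h82 : nn 8 (RT x y 2 (Wval z D)) = z := num6 h22 m26 s4
  have one : ∀ j r, qT (tg j) = 1 → j ∈ RT x y r (Wval z D) → y j = r := by
    intro j r h h'
    rw [hmem, h] at h'
    omega
  have hio : ∑ j ∈ RT x y 1 (Wval z D), io ι j = ∑ j, io ι j := by
    rw [io_tot, hsum, r1, h71]
  intro j
  cases j with
  | JA i => exact yA _ rfl
  | JB i => exact yB _ rfl
  | Ja i => exact ya _ rfl
  | Jb i => exact yb _ rfl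
  | Jc i => exact yc _ rfl
  | Jα i => exact yα _ rfl
  | Jβ i => exact yβ _ rfl
  | Jγ i => exact one _ _ rfl (nn_all (k := 7) h71 rfl)
  | Jδ i => exact one _ _ rfl (nn_all (k := 8) h82 rfl)
  | Jl1 => exact hl
  | Jl2 => exact one _ _ rfl (nn_all (k := 10) l23 rfl)
  | Jpart i => exact one _ _ rfl (io_all hι hio rfl)

end

section
variable {z D : ℕ} {ι : Fin (3*z) → ℕ} {x y : Job z → ℕ}

theorem nn_row (hN : ∀ j, y j = yT (tg j)) (k r t : ℕ) :
    nn k (RT x y r t) = if yT k ≤ r ∧ r < yT k + qT k then nn k (Bf x t) else 0 := by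
  split_ifs with h
  · rw [nn_card, nn_card]
    congr 1
    ext j
    simp only [RT, Bf, Finset.mem_filter, Finset.mem_univ, true_and, hN, q_tag]
    constructor
    · rintro ⟨⟨a, _⟩, b⟩; exact ⟨a, b⟩
    · rintro ⟨a, b⟩; refine ⟨⟨a, ?_⟩, b⟩; rw [b]; exact h
  · apply nn_zero'
    intro j hj hm
    simp only [RT, Finset.mem_filter, Finset.mem_univ, true_and, hN, q_tag, hj] at hm
    exact h hm.2

theorem io_row (hN : ∀ j, y j = yT (tg j)) (r t : ℕ) :
    ∑ j ∈ RT x y r t, io ι j = if r = 1 then ∑ j ∈ Bf x t, io ι j else 0 := by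
  simp only [RT, Bf, Finset.sum_filter, hN, q_tag]
  split_ifs with h
  · apply Finset.sum_congr rfl
    intro j _
    cases j with
    | Jpart i => simp [tg, yT, qT, h]
    | _ => simp [io]
  · apply Finset.sum_eq_zero
    intro j _
    cases j with
    | Jpart i =>
      simp only [tg, yT, qT]
      rw [if_neg]; omega
    | _ => simp [io]

structure Good (z D : ℕ) (ι : Fin (3*z) → ℕ) (x y : Job z → ℕ) : Prop where
  hz : 0 < z
  hD : 4*z*(7*z+1) < D
  hι : ∀ i, 0 < ι i
  hsum : ∑ i, ι i = z * D
  hF : PackFeasible (Wval z D) (pJob z D ι) (qJob z) x y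
  hy : ∀ j, y j + qJob z j ≤ 4
  hN : ∀ j, y j = yT (tg j)

theorem Good.hD1 (g : Good z D ι x y) : 1 < D := by
  have := g.hz; have := g.hD; nlinarith

theorem Good.rows (g : Good z D ι x y) {r s t : ℕ} (hr : r < 4) (hs : s < 4)
    (h : Bd (Wval z D) x y r t) (h' : Bd (Wval z D) x y s t) :
    ∑ j ∈ RT x y r t, pJob z D ι j = ∑ j ∈ RT x y s t, pJob z D ι j :=
  (row_t g.hz g.hD1 g.hι g.hsum g.hF g.hy hr h).trans
      (row_t g.hz g.hD1 g.hι g.hsum g.hF g.hy hs h').symm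

def N (x : Job z → ℕ) (k t : ℕ) : ℕ := nn k (Bf x t)

theorem Good.rel01 (g : Good z D ι x y) {t : ℕ}
    (h : Bd (Wval z D) x y 0 t) (h' : Bd (Wval z D) x y 1 t) :
    N x 4 t = N x 1 t ∧ N x 4 t = N x 5 t + N x 9 t ∧ N x 7 t = N x 5 t := by
  obtain ⟨e1, e2, e3, e4, e5, e6, e7, e8⟩ := digits_eq z D ι g.hz g.hsum g.hD _ _
    (g.rows (by norm_num) (by norm_num) h h')
  clear e1 e7
  simp [nn_row g.hN, yT, qT] at e2 e3 e4 e5 e6 e8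
  unfold N
  omega

theorem Good.rel12 (g : Good z D ι x y) {t : ℕ}
    (h : Bd (Wval z D) x y 1 t) (h' : Bd (Wval z D) x y 2 t) :
    N x 2 t = N x 3 t ∧ N x 7 t = N x 2 t ∧ N x 8 t = N x 2 t ∧
    ∑ j ∈ Bf x t, io ι j = N x 7 t * D := by
  obtain ⟨e1, e2, e3, e4, e5, e6, e7, e8⟩ := digits_eq z D ι g.hz g.hsum g.hD _ _
    (g.rows (by norm_num) (by norm_num) h h')
  clear e7
  simp [nn_row g.hN, io_row g.hN, yT, qT] at e1 e2 e3 e4 e5 e6 e8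
  unfold N
  refine ⟨by omega, by omega, by omega, e1⟩

theorem Good.rel23 (g : Good z D ι x y) {t : ℕ}
    (h : Bd (Wval z D) x y 2 t) (h' : Bd (Wval z D) x y 3 t) :
    N x 4 t = N x 0 t ∧ N x 4 t = N x 6 t + N x 10 t ∧ N x 8 t = N x 6 t := by
  obtain ⟨e1, e2, e3, e4, e5, e6, e7, e8⟩ := digits_eq z D ι g.hz g.hsum g.hD _ _
    (g.rows (by norm_num) (by norm_num) h h')
  clear e1 e7
  simp [nn_row g.hN, yT, qT] at e2 e3 e4 e5 e6 e8
  unfold N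
  omega

theorem Good.bd (g : Good z D ι x y) {r k : ℕ} {j : Job z} (hj : tg j = k)
    (h : yT k ≤ r ∧ r < yT k + qT k) : Bd (Wval z D) x y r (x j) :=
  Or.inr ⟨j, rfl, by rw [g.hN, q_tag, hj]; exact h⟩

theorem Good.ne (g : Good z D ι x y) (r : ℕ) {k l : ℕ} {i j : Job z} (hi : tg i = k) (hj : tg j = l)
    (h : yT k ≤ r ∧ r < yT k + qT k) (h' : yT l ≤ r ∧ r < yT l + qT l) (hij : i ≠ j) : x i ≠ x j :=
  xne (r := r) g.hD1 g.hι g.hF (by rw [g.hN, q_tag, hi]; exact h) (by rw [g.hN, q_tag, hj]; exact h') hij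

theorem N_mono (k : ℕ) {s t : ℕ} (h : s ≤ t) : N x k s ≤ N x k t :=
  nn_mono k (fun j hj => by simp [Bf] at hj ⊢; omega)

theorem N_le {k l : ℕ} {s t : ℕ} (h : ∀ j, tg j = k → x j < s → x j < t) (hl : l = k) :
    N x k s ≤ N x l t := by
  subst hl
  unfold N
  rw [nn_card, nn_card]
  apply Finset.card_le_card
  intro j hj
  simp only [Bf, Finset.mem_filter, Finset.mem_univ, true_and] at hj ⊢
  exact ⟨h j hj.2 hj.1, hj.2⟩

theorem N_lt {k : ℕ} {s t : ℕ} (h : s ≤ t) {j : Job z} (hj : tg j = k) (h1 : s ≤ x j) (h2 : x j < t) :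
    N x k s < N x k t := by
  unfold N
  rw [nn_card, nn_card]
  apply Finset.card_lt_card
  rw [Finset.ssubset_iff]
  refine ⟨j, ?_, ?_⟩
  · simp [Bf]; omega
  · intro i hi
    simp only [Finset.mem_insert, Bf, Finset.mem_filter, Finset.mem_univ, true_and] at hi ⊢
    rcases hi with rfl | hi
    · exact ⟨h2, hj⟩
    · exact ⟨by omega, hi.2⟩

theorem N_ex {k : ℕ} {s t : ℕ} (h : N x k s < N x k t) : ∃ j, tg j = k ∧ s ≤ x j ∧ x j < t := by
  by_contra hn
  push Not at hn
  have := N_le (x := x) (k := k) (s := t) (t := s) (fun j hj h2 => by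
    by_contra h3
    have := hn j hj (by omega)
    omega) rfl
  omega

theorem N_lam {k t : ℕ} (hk : k = 9 ∨ k = 10) : N x k t ≤ 1 := by
  have := nn_le k (Bf x t)
  rcases hk with rfl | rfl <;> exact this

/-- the jump lemma: `c` changes between -/
theorem Good.jump (g : Good z D ι x y) {t t' ka kb : ℕ} (htt : t ≤ t')
    (hab : (ka = 2 ∧ kb = 3) ∨ (ka = 3 ∧ kb = 2))
    (hA : ∀ j, tg j = ka → t ≤ x j → x j < t' → N x 4 (x j) = N x 4 t)
    (hB : ∀ j, tg j = kb → t ≤ x j → x j < t' → N x 4 (x j) = N x 4 t')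
    (hc : N x 4 t < N x 4 t') : N x ka t' ≤ N x kb t := by
  obtain ⟨c, hc4, hc1, hc2⟩ := N_ex hc
  have h12 := (g.rel12 (t := x c) (g.bd hc4 (by decide)) (g.bd hc4 (by decide))).1
  have h1 : N x ka t' ≤ N x ka (x c) := N_le (fun j hj hj' => by
    by_contra hn
    have hne : x c ≠ x j := by
      rcases hab with ⟨rfl, rfl⟩ | ⟨rfl, rfl⟩
      · exact g.ne 1 hc4 hj (by decide) (by decide) (by rintro rfl; omega)
      · exact g.ne 2 hc4 hj (by decide) (by decide) (by rintro rfl; omega)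
    have e := hA j hj (by omega) hj'
    have := N_lt (x := x) (s := t) (t := x j) (by omega) hc4 hc1 (by omega)
    omega) rfl
  have h2 : N x kb (x c) ≤ N x kb t := N_le (fun j hj hj' => by
    by_contra hn
    have e := hB j hj (by omega) (by omega)
    have := N_lt (x := x) (s := x j) (t := t') (by omega) hc4 (by omega) hc2
    omega) rfl
  rcases hab with ⟨rfl, rfl⟩ | ⟨rfl, rfl⟩ <;> omega

theorem Good.bound (g : Good z D ι x y) {t' : ℕ}
    (ht : t' = Wval z D ∨ ∃ e, tg e ≤ 1 ∧ x e = t') :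
    N x 7 t' = 0 ∨ ∃ e, tg e ≤ 1 ∧ x e < t' ∧ N x 7 t' ≤ N x 7 (x e) + 1 := by
  -- relations at `t'`
  have b1 : Bd (Wval z D) x y 1 t' := by
    rcases ht with rfl | ⟨e, he, rfl⟩
    · exact Or.inl rfl
    · have : tg e = 0 ∨ tg e = 1 := by omega
      rcases this with h | h <;> exact g.bd h (by decide)
  have b2 : Bd (Wval z D) x y 2 t' := by
    rcases ht with rfl | ⟨e, he, rfl⟩
    · exact Or.inl rfl
    · have : tg e = 0 ∨ tg e = 1 := by omega
      rcases this with h | h <;> exact g.bd h (by decide)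
  have h12' := g.rel12 b1 b2
  have hlike : (Bd (Wval z D) x y 0 t' ∧ Bd (Wval z D) x y 3 t') ∨
      (Bd (Wval z D) x y 0 t' ∧ ∃ e, tg e = 0 ∧ x e = t') ∨
      (Bd (Wval z D) x y 3 t' ∧ ∃ e, tg e = 1 ∧ x e = t') := by
    rcases ht with rfl | ⟨e, he, rfl⟩
    · exact Or.inl ⟨Or.inl rfl, Or.inl rfl⟩
    · have : tg e = 0 ∨ tg e = 1 := by omega
      rcases this with h | h
      · exact Or.inr (Or.inl ⟨g.bd h (by decide), e, h, rfl⟩)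
      · exact Or.inr (Or.inr ⟨g.bd h (by decide), e, h, rfl⟩)
  let E : Finset (Job z) := Finset.univ.filter (fun e => tg e ≤ 1 ∧ x e < t')
  by_cases hE : E.Nonempty
  swap
  · left
    rw [Finset.not_nonempty_iff_eq_empty, Finset.filter_eq_empty_iff] at hE
    have hk : ∀ k, k ≤ 1 → N x k t' = 0 := fun k hk => nn_zero' (fun j hj hm => by
      simp only [Bf, Finset.mem_filter, Finset.mem_univ, true_and] at hm
      exact hE (Finset.mem_univ j) ⟨by omega, hm⟩)
    have h0 := hk 0 (by norm_num)
    have h1 := hk 1 (by norm_num)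
    have hor : Bd (Wval z D) x y 0 t' ∨ Bd (Wval z D) x y 3 t' := by
      rcases hlike with h | h | h
      · exact Or.inl h.1
      · exact Or.inl h.1
      · exact Or.inr h.1
    rcases hor with h | h
    · have := g.rel01 h b1; omega
    · have := g.rel23 b2 h; omega
  · right
    obtain ⟨e, he, hmax⟩ := Finset.exists_max_image E x hE
    simp only [E, Finset.mem_filter, Finset.mem_univ, true_and] at he hmax
    refine ⟨e, he.1, he.2, ?_⟩
    obtain ⟨he1, het⟩ := he
    have h97 := N_lam (x := x) (k := 9) (t := x e) (by simp)
    have h107 := N_lam (x := x) (k := 10) (t := x e) (by simp)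
    have m := fun k => N_mono (x := x) k het.le
    have m5 := m 5
    have m9 := m 9
    have m6 := m 6
    have m10 := m 10
    have m4 := m 4
    have he01 : tg e = 0 ∨ tg e = 1 := by omega
    rcases he01 with h | h
    · have r12 := g.rel12 (t := x e) (g.bd h (by decide)) (g.bd h (by decide))
      have r01 := g.rel01 (t := x e) (g.bd h (by decide)) (g.bd h (by decide))
      have hB : ∀ s, x e ≤ s → s ≤ t' → N x 1 s = N x 1 (x e) := fun s hs hs' =>
        le_antisymm (N_le (fun j hj hj' => by
          have h1 := hmax j ⟨by omega, by omega⟩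
          have h2 := g.ne 1 hj h (by decide) (by decide) (by rintro rfl; omega)
          omega) rfl) (N_mono 1 hs)
      have hB' := hB t' het.le le_rfl
      have hcase : Bd (Wval z D) x y 0 t' ∨ (Bd (Wval z D) x y 3 t' ∧ ∃ e, tg e = 1 ∧ x e = t') := by
        rcases hlike with h | h | h
        · exact Or.inl h.1
        · exact Or.inl h.1
        · exact Or.inr h
      rcases hcase with h0 | ⟨h3, f, hf, hft⟩
      · have r01' := g.rel01 h0 b1
        omega
      · have r23' := g.rel23 b2 h3
        by_cases hc : N x 4 (x e) < N x 4 t'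
        · have := g.jump (t := x e) (t' := t') (ka := 2) (kb := 3) het.le (by simp)
            (fun j hj h1 h2 => by
              have a1 := g.rel01 (t := x j) (g.bd hj (by decide)) (g.bd hj (by decide))
              have a2 := hB (x j) h1 h2.le
              omega)
            (fun j hj h1 h2 => by
              have a1 := g.rel23 (t := x j) (g.bd hj (by decide)) (g.bd hj (by decide))
              have a2 : N x 0 t' ≤ N x 0 (x j) := N_le (fun i hi hi' => by
                have h3 := hmax i ⟨by omega, by omega⟩
                have h4 := g.ne 2 hi hj (by decide) (by decide) (by rintro rfl; omega)
                omega) rfl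
              have a3 := N_mono (x := x) 0 h2.le
              omega) hc
          omega
        · omega
    · have r12 := g.rel12 (t := x e) (g.bd h (by decide)) (g.bd h (by decide))
      have r23 := g.rel23 (t := x e) (g.bd h (by decide)) (g.bd h (by decide))
      have hB : ∀ s, x e ≤ s → s ≤ t' → N x 0 s = N x 0 (x e) := fun s hs hs' =>
        le_antisymm (N_le (fun j hj hj' => by
          have h1 := hmax j ⟨by omega, by omega⟩
          have h2 := g.ne 1 hj h (by decide) (by decide) (by rintro rfl; omega)
          omega) rfl) (N_mono 0 hs)
      have hB' := hB t' het.le le_rfl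
      have hcase : Bd (Wval z D) x y 3 t' ∨ (Bd (Wval z D) x y 0 t' ∧ ∃ e, tg e = 0 ∧ x e = t') := by
        rcases hlike with h | h | h
        · exact Or.inl h.2
        · exact Or.inr h
        · exact Or.inl h.1
      rcases hcase with h0 | ⟨h3, f, hf, hft⟩
      · have r23' := g.rel23 b2 h0
        omega
      · have r01' := g.rel01 h3 b1
        by_cases hc : N x 4 (x e) < N x 4 t'
        · have := g.jump (t := x e) (t' := t') (ka := 3) (kb := 2) het.le (by simp)
            (fun j hj h1 h2 => by
              have a1 := g.rel23 (t := x j) (g.bd hj (by decide)) (g.bd hj (by decide))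
              have a2 := hB (x j) h1 h2.le
              omega)
            (fun j hj h1 h2 => by
              have a1 := g.rel01 (t := x j) (g.bd hj (by decide)) (g.bd hj (by decide))
              have a2 : N x 1 t' ≤ N x 1 (x j) := N_le (fun i hi hi' => by
                have h3 := hmax i ⟨by omega, by omega⟩
                have h4 := g.ne 1 hi hj (by decide) (by decide) (by rintro rfl; omega)
                omega) rfl
              have a3 := N_mono (x := x) 1 h2.le
              omega) hc
          omega
        · omega

theorem Good.exT (g : Good z D ι x y) {k : ℕ} (hk : k ≤ z) :
    ∃ t, N x 7 t = k ∧ ∑ j ∈ Bf x t, io ι j = k * D := by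
  let P : ℕ → Prop := fun t => (t = Wval z D ∨ ∃ e, tg e ≤ 1 ∧ x e = t) ∧ k ≤ N x 7 t
  have hW : P (Wval z D) := by
    refine ⟨Or.inl rfl, ?_⟩
    have : N x 7 (Wval z D) = z := nn_all' (k := 7) (fun j _ => by
      simp only [Bf, Finset.mem_filter, Finset.mem_univ, true_and]
      have := g.hF.1 j
      have := p_pos z D ι g.hD1 g.hι j
      omega)
    omega
  classical
  have hex : ∃ t, P t := ⟨_, hW⟩
  obtain ⟨h1, h2⟩ := Nat.find_spec hex
  have hmin : ∀ s, s < Nat.find hex → ¬ P s := fun s hs => Nat.find_min hex hs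
  generalize Nat.find hex = t at *
  have hkt : N x 7 t = k := by
    rcases g.bound h1 with h | ⟨e, he, het, hle⟩
    · omega
    · have := hmin (x e) het
      have hlt : ¬ k ≤ N x 7 (x e) := fun hh => this ⟨Or.inr ⟨e, he, rfl⟩, hh⟩
      omega
  refine ⟨t, hkt, ?_⟩
  rw [← hkt]
  rcases h1 with rfl | ⟨e, he, rfl⟩
  · exact (g.rel12 (Or.inl rfl) (Or.inl rfl)).2.2.2
  · have : tg e = 0 ∨ tg e = 1 := by omega
    rcases this with h | h <;> exact (g.rel12 (g.bd h (by decide)) (g.bd h (by decide))).2.2.2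

theorem io_Bf (t : ℕ) : ∑ j ∈ Bf x t, io ι j =
    ∑ i ∈ Finset.univ.filter (fun i => x (.Jpart i) < t), ι i := by
  simp only [Bf, Finset.sum_filter]
  rw [job_sum]
  simp [io]

theorem Good.yes (g : Good z D ι x y) : IsYes z D ι := by
  have hT : ∀ k, ∃ t, k ≤ z → N x 7 t = k ∧
      ∑ i ∈ Finset.univ.filter (fun i => x (.Jpart i) < t), ι i = k * D := by
    intro k
    by_cases hk : k ≤ z
    · obtain ⟨t, h1, h2⟩ := g.exT hk
      exact ⟨t, fun _ => ⟨h1, by rw [← io_Bf]; exact h2⟩⟩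
    · exact ⟨0, fun h => absurd h hk⟩
  choose T hT using hT
  have hmono : ∀ k l, k ≤ l → l ≤ z → T k ≤ T l := by
    intro k l hkl hl
    by_contra hn
    have h1 := (hT k (by omega)).1
    have h2 := (hT l hl).1
    have h3 := N_mono (x := x) 7 (show T l ≤ T k by omega)
    have : k = l := by omega
    subst this
    omega
  have hlast : ∀ i, x (.Jpart i) < T z := by
    intro i
    by_contra hn
    have h := (hT z le_rfl).2
    rw [← g.hsum] at h
    have hlt : ∑ i ∈ Finset.univ.filter (fun i => x (.Jpart i) < T z), ι i < ∑ i, ι i :=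
      Finset.sum_lt_sum_of_subset (Finset.subset_univ _) (Finset.mem_univ i) (by simpa using hn)
        (g.hι i) (fun _ _ _ => Nat.zero_le _)
    omega
  have hfirst : ∀ i, ¬ x (.Jpart i) < T 0 := by
    intro i hi
    have h := (hT 0 (Nat.zero_le _)).2
    rw [zero_mul, Finset.sum_eq_zero_iff] at h
    have := h i (by simpa using hi)
    have := g.hι i
    omega
  have hex : ∀ i, ∃ k : Fin z, x (.Jpart i) < T (k.val+1) ∧ ¬ x (.Jpart i) < T k.val := by
    intro i
    classical
    have he : ∃ k, x (.Jpart i) < T k := ⟨z, hlast i⟩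
    have h1 := Nat.find_spec he
    have h2 : Nat.find he ≤ z := Nat.find_min' he (hlast i)
    have h3 : Nat.find he ≠ 0 := fun h0 => hfirst i (by rw [h0] at h1; exact h1)
    have h4 : ¬ x (.Jpart i) < T (Nat.find he - 1) := Nat.find_min he (by omega)
    refine ⟨⟨Nat.find he - 1, by omega⟩, ?_, h4⟩
    have : Nat.find he - 1 + 1 = Nat.find he := by omega
    simp only [this]
    exact h1
  choose f hf using hex
  refine ⟨f, fun k => ?_⟩
  have hk := k.2
  have e1 := (hT (k.val+1) (by omega)).2
  have e0 := (hT k.val (by omega)).2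
  have hfk : ∀ i, f i = k ↔ (x (.Jpart i) < T (k.val+1) ∧ ¬ x (.Jpart i) < T k.val) := by
    intro i
    constructor
    · rintro rfl; exact hf i
    · rintro ⟨h1, h2⟩
      obtain ⟨h3, h4⟩ := hf i
      have hfi := (f i).2
      rcases lt_trichotomy (f i).val k.val with h | h | h
      · have := hmono ((f i).val+1) k.val h (by omega); omega
      · exact Fin.ext h
      · have := hmono (k.val+1) (f i).val h (by omega); omega
  rw [← Finset.sum_filter_add_sum_filter_not _ (fun i => x (.Jpart i) < T k.val),
    Finset.filter_filter, Finset.filter_filter] at e1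
  have h1 : Finset.univ.filter (fun i => x (.Jpart i) < T (k.val+1) ∧ x (.Jpart i) < T k.val)
      = Finset.univ.filter (fun i => x (.Jpart i) < T k.val) := by
    ext i
    have := hmono k.val (k.val+1) (by omega) (by omega)
    simp only [Finset.mem_filter, Finset.mem_univ, true_and]
    omega
  have h2 : Finset.univ.filter (fun i => f i = k)
      = Finset.univ.filter (fun i => x (.Jpart i) < T (k.val+1) ∧ ¬ x (.Jpart i) < T k.val) := by
    ext i
    simp only [Finset.mem_filter, Finset.mem_univ, true_and, hfk]
  rw [h2]
  rw [h1, e0] at e1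
  have : (k.val+1)*D = k.val*D + D := by ring
  omega

theorem main_yes (hz : 0 < z) (hDb : 4*z*(7*z+1) < D) (hι : ∀ i, 0 < ι i) (hsum : ∑ i, ι i = z * D)
    (hF : PackFeasible (Wval z D) (pJob z D ι) (qJob z) x y)
    (hy : ∀ j, y j + qJob z j ≤ 4) : IsYes z D ι := by
  have hD : 1 < D := by nlinarith
  have hx : x .Jl1 < Wval z D := by
    have := hF.1 .Jl1
    have := p_pos z D ι hD hι .Jl1
    omega
  obtain ⟨_, _, m1, _, _⟩ := mid_facts hz hDb hι hsum hF hy (r := 1) (by simp)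
  obtain ⟨_, _, m2, _, _⟩ := mid_facts hz hDb hι hsum hF hy (r := 2) (by simp)
  have n1 := nn_zero m1 (j := .Jl1) rfl
  have n2 := nn_zero m2 (j := .Jl1) rfl
  have h4 := hy .Jl1
  have hq : qJob z .Jl1 = 1 := rfl
  simp only [RT, Finset.mem_filter, Finset.mem_univ, true_and, hx, hq] at n1 n2
  have h03 : y .Jl1 = 0 ∨ y .Jl1 = 3 := by omega
  rcases h03 with h | h
  · exact Good.yes ⟨hz, hDb, hι, hsum, hF, hy, normal_form hz hDb hι hsum hF hy h⟩
  · have hF' : PackFeasible (Wval z D) (pJob z D ι) (qJob z) x (fun j => 4 - qJob z j - y j) := by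
      refine ⟨hF.1, fun i j hij => ?_⟩
      have hi := hy i
      have hj := hy j
      rcases hF.2 i j hij with h | h | h | h
      · exact Or.inl h
      · exact Or.inr (Or.inl h)
      · right; right; right; show 4 - qJob z j - y j + qJob z j ≤ 4 - qJob z i - y i; omega
      · right; right; left; show 4 - qJob z i - y i + qJob z i ≤ 4 - qJob z j - y j; omega
    have hy' : ∀ j, (fun j => 4 - qJob z j - y j) j + qJob z j ≤ 4 := fun j => by
      have := hy j
      show 4 - qJob z j - y j + qJob z j ≤ 4
      omega
    exact Good.yes ⟨hz, hDb, hι, hsum, hF', hy', normal_form hz hDb hι hsum hF' hy'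
      (by show 4 - qJob z .Jl1 - y .Jl1 = 0; omega)⟩

end
end SP

/-- If the constructed items admit a feasible packing into a strip of width `W` of height
at most 4, then the 3-Partition instance is a Yes-instance; consequently, for a
No-instance every feasible packing has height at least 5. -/
theorem packing_height_four_to_yes
    (z D : ℕ) (ι : Fin (3*z) → ℕ)
    (hz : 0 < z) (hDpos : 0 < D)
    (hιpos : ∀ i, 0 < ι i)
    (hsum : ∑ i, ι i = z * D)
    (hlow : ∀ i, D < 4 * ι i)
    (hhigh : ∀ i, 2 * ι i < D)
    (hD : 4*z*(7*z+1) < D) :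
    ((∃ (x y : Job z → ℕ),
        PackFeasible (Wval z D) (pJob z D ι) (qJob z) x y ∧
        ∀ j, y j + qJob z j ≤ 4) → IsYes z D ι) ∧
    (¬ IsYes z D ι →
      ∀ (x y : Job z → ℕ),
        PackFeasible (Wval z D) (pJob z D ι) (qJob z) x y →
        5 ≤ makespan (qJob z) y) := by
  refine ⟨fun ⟨x, y, hF, hy⟩ => SP.main_yes hz hD hιpos hsum hF hy, fun hno x y hF => ?_⟩
  by_contra hlt
  apply hno
  apply SP.main_yes hz hD hιpos hsum hF
  intro j
  have h : y j + qJob z j ≤ makespan (qJob z) y :=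
    Finset.le_sup (f := fun j => y j + qJob z j) (Finset.mem_univ j)
  omega
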